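/- Let C > 0 and set α = (2/π)·arctan C, so 0 < α < 1. Let p : 𝔻 × [0,∞) → ℂ be such that for each t the map z ↦ p(z,t) is holomorphic on 𝔻 with p(0,t) = 1, Re p(z,t) > 0, and |Im p(z,t)| ≤ C·Re p(z,t) for all z ∈ 𝔻. Let w : 𝔻 × [0,∞) → 𝔻 satisfy w(z,0) = z, for each z ∈ 𝔻 the map t ↦ w(z,t) is differentiable with ∂w/∂t = −w·p(w,t), and for each t the map z ↦ w(z,t) is holomorphic and injective on 𝔻. Then for each t ≥ 0 and each ε with 0 < ε < 1−α there exist M > 0 and a continuous injective map W : closure(𝔻) → ℂ extending z ↦ w(z,t) such that |W(z₁) − W(z₂)| ≤ M·|z₁ − z₂|^{1−α−ε} for all z₁, z₂ in the closed unit disc; in particular the boundary of the domain w(𝔻,t) is a Jordan curve (the injective continuous image of the unit circle under W). -/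

import Mathlib

open Complex Set Real



lemma lk_mob {a b : ℂ} (ha : ‖a‖ < 1) (hb : ‖b‖ < 1) :
    ‖a + b‖ < ‖1 + (starRingEnd ℂ) b * a‖ := by
  have h1 : ‖a‖^2 < 1 := by nlinarith [norm_nonneg a]
  have h2 : ‖b‖^2 < 1 := by nlinarith [norm_nonneg b]
  have : ‖a + b‖^2 < ‖1 + (starRingEnd ℂ) b * a‖^2 := by
    rw [← Complex.normSq_eq_norm_sq, Complex.normSq_apply] at *
    rw [← Complex.normSq_eq_norm_sq, Complex.normSq_apply] at *
    simp
    nlinarith [mul_pos (sub_pos.2 h1) (sub_pos.2 h2)]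
  exact lt_of_pow_lt_pow_left₀ 2 (norm_nonneg _) this

lemma lk_half {a b : ℂ} (ha : 0 < a.re) (hb : 0 < b.re) :
    ‖a - b‖ < ‖a + (starRingEnd ℂ) b‖ := by
  have : ‖a - b‖^2 < ‖a + (starRingEnd ℂ) b‖^2 := by
    rw [← Complex.normSq_eq_norm_sq, Complex.normSq_apply]
    rw [← Complex.normSq_eq_norm_sq, Complex.normSq_apply]
    simp
    nlinarith [mul_pos ha hb]
  exact lt_of_pow_lt_pow_left₀ 2 (norm_nonneg _) this

lemma lk_sp {q : ℂ → ℂ} (hq : DifferentiableOn ℂ q (Metric.ball 0 1))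
    (hre : ∀ z ∈ Metric.ball (0:ℂ) 1, 0 < (q z).re) {z : ℂ} (hz : ‖z‖ < 1) :
    ‖deriv q z‖ * (1 - ‖z‖^2) ≤ 2 * (q z).re := by
  set m : ℂ → ℂ := fun ζ => (ζ + z) / (1 + (starRingEnd ℂ) z * ζ) with hm
  have hz' : z ∈ Metric.ball (0:ℂ) 1 := by simpa using hz
  have hne : ∀ ζ ∈ Metric.ball (0:ℂ) 1, 1 + (starRingEnd ℂ) z * ζ ≠ 0 := by
    intro ζ hζ h
    have := lk_mob (a := ζ) (b := z) (by simpa using hζ) hz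
    rw [h] at this; simp at this
    exact absurd this (not_lt.2 (norm_nonneg _))
  have hmm : MapsTo m (Metric.ball 0 1) (Metric.ball 0 1) := by
    intro ζ hζ
    have := lk_mob (a := ζ) (b := z) (by simpa using hζ) hz
    simp only [hm, mem_ball_zero_iff, norm_div]
    rw [div_lt_one (lt_of_le_of_lt (norm_nonneg _) this)]
    exact this
  have hmd : DifferentiableOn ℂ m (Metric.ball 0 1) := by
    intro ζ hζ
    apply DifferentiableAt.differentiableWithinAt
    have e1 : DifferentiableAt ℂ (fun ζ : ℂ => ζ + z) ζ := by fun_prop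
    have e2 : DifferentiableAt ℂ (fun ζ : ℂ => 1 + (starRingEnd ℂ) z * ζ) ζ := by fun_prop
    exact e1.div e2 (hne ζ hζ)
  set g : ℂ → ℂ := fun ζ => (q (m ζ) - q z) / (q (m ζ) + (starRingEnd ℂ) (q z)) with hg
  have hgne : ∀ ζ ∈ Metric.ball (0:ℂ) 1, q (m ζ) + (starRingEnd ℂ) (q z) ≠ 0 := by
    intro ζ hζ h
    have := lk_half (hre _ (hmm hζ)) (hre _ hz')
    rw [h] at this; simp at this
    exact absurd this (not_lt.2 (norm_nonneg _))
  have hqm : DifferentiableOn ℂ (fun ζ => q (m ζ)) (Metric.ball 0 1) := hq.comp hmd hmm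
  have hgd : DifferentiableOn ℂ g (Metric.ball 0 1) :=
    (hqm.sub_const _).div (hqm.add_const _) hgne
  have hm0 : m 0 = z := by simp [hm]
  have hg0 : g 0 = 0 := by simp [hg, hm0]
  have hgm : MapsTo g (Metric.ball 0 1) (Metric.closedBall (g 0) 1) := by
    intro ζ hζ
    have := lk_half (hre _ (hmm hζ)) (hre _ hz')
    rw [hg0]
    simp only [hg, mem_closedBall_zero_iff, norm_div]
    rw [div_le_one (lt_of_le_of_lt (norm_nonneg _) this)]
    exact this.le
  have key := Complex.norm_deriv_le_one_of_mapsTo_ball hgd hgm one_pos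
  have hmder : HasDerivAt m (1 - z * (starRingEnd ℂ) z) 0 := by
    have h1 : HasDerivAt (fun ζ : ℂ => ζ + z) 1 0 := (hasDerivAt_id _).add_const _
    have h2 : HasDerivAt (fun ζ : ℂ => 1 + (starRingEnd ℂ) z * ζ) ((starRingEnd ℂ) z) 0 := by
      simpa using ((hasDerivAt_id (0:ℂ)).const_mul ((starRingEnd ℂ) z)).const_add 1
    exact (h1.div h2 (by simp)).congr_deriv (by simp)
  have hqd : HasDerivAt q (deriv q z) (m 0) := by
    rw [hm0]
    exact (hq.differentiableAt (Metric.isOpen_ball.mem_nhds hz')).hasDerivAt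
  have hc := hqd.comp 0 hmder
  have hqre := hre z hz'
  have hgder : HasDerivAt g (deriv q z * (1 - z * (starRingEnd ℂ) z) / (2 * (q z).re)) 0 := by
    have := (hc.sub_const (q z)).div (hc.add_const ((starRingEnd ℂ) (q z))) (hgne 0 (by simp))
    refine this.congr_deriv ?_
    have e : q z + (starRingEnd ℂ) (q z) = 2 * (q z).re := by
      rw [Complex.add_conj]; push_cast; ring
    have e2 : (2 * ((q z).re : ℂ)) ≠ 0 := by
      have : ((q z).re : ℂ) ≠ 0 := by exact_mod_cast hqre.ne'
      simpa using this
    simp only [Function.comp, hm0, e, sub_self, zero_mul, sub_zero]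
    field_simp
  rw [hgder.deriv] at key
  have e3 : (1 - z * (starRingEnd ℂ) z) = ((1 - ‖z‖^2 : ℝ) : ℂ) := by
    rw [Complex.mul_conj, Complex.normSq_eq_norm_sq]; push_cast; rfl
  have e4 : (2 * ((q z).re : ℂ)) = ((2 * (q z).re : ℝ) : ℂ) := by push_cast; rfl
  rw [e3, e4, norm_div, norm_mul, Complex.norm_real, Complex.norm_real, Real.norm_of_nonneg,
    Real.norm_of_nonneg, div_le_one] at key
  · exact key
  · linarith
  · linarith
  · nlinarith [norm_nonneg z]

lemma lk_bd {q : ℂ → ℂ} (hq : DifferentiableOn ℂ q (Metric.ball 0 1))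
    (hre : ∀ z ∈ Metric.ball (0:ℂ) 1, 0 < (q z).re) (h1 : q 0 = 1) {z : ℂ} (hz : ‖z‖ < 1) :
    ‖q z‖ ≤ 2 / (1 - ‖z‖) := by
  have hz' : z ∈ Metric.ball (0:ℂ) 1 := by simpa using hz
  set g : ℂ → ℂ := fun ζ => (q ζ - 1) / (q ζ + 1) with hg
  have hl : ∀ ζ ∈ Metric.ball (0:ℂ) 1, ‖q ζ - 1‖ < ‖q ζ + 1‖ := by
    intro ζ hζ
    simpa using lk_half (hre _ hζ) (b := 1) (by simp)
  have hp : ∀ ζ ∈ Metric.ball (0:ℂ) 1, 0 < ‖q ζ + 1‖ := fun ζ hζ =>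
    lt_of_le_of_lt (norm_nonneg _) (hl ζ hζ)
  have hgd : DifferentiableOn ℂ g (Metric.ball 0 1) :=
    (hq.sub_const _).div (hq.add_const _) (fun ζ hζ => norm_pos_iff.1 (hp ζ hζ))
  have hgm : MapsTo g (Metric.ball 0 1) (Metric.closedBall 0 1) := by
    intro ζ hζ
    simp only [hg, mem_closedBall_zero_iff, norm_div]
    rw [div_le_one (hp ζ hζ)]
    exact (hl ζ hζ).le
  have key := Complex.norm_le_norm_of_mapsTo_ball hgd hgm (by simp [hg, h1]) hz
  simp only [hg, norm_div] at key
  rw [div_le_iff₀ (hp z hz')] at key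
  have a1 : ‖q z‖ ≤ ‖q z - 1‖ + 1 := by
    have := norm_add_le (q z - 1) 1
    simpa using this
  have a2 : ‖q z + 1‖ ≤ ‖q z‖ + 1 := by
    have := norm_add_le (q z) 1
    simpa using this
  rw [le_div_iff₀ (by linarith)]
  nlinarith [norm_nonneg z]

lemma lk_sector {C β : ℝ} (hC : 0 < C) (hβ : (2/π) * Real.arctan C < β) (hβ1 : β < 1)
    {q : ℂ → ℂ} (hq : DifferentiableOn ℂ q (Metric.ball 0 1))
    (hre : ∀ z ∈ Metric.ball (0:ℂ) 1, 0 < (q z).re)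
    (hs : ∀ z ∈ Metric.ball (0:ℂ) 1, |(q z).im| ≤ C * (q z).re) {z : ℂ} (hz : ‖z‖ < 1) :
    ‖deriv q z‖ * (1 - ‖z‖^2) ≤ 2 * β * (q z).re := by
  have hz' : z ∈ Metric.ball (0:ℂ) 1 := by simpa using hz
  have hat : 0 < Real.arctan C := Real.arctan_pos.2 hC
  have hβ0 : 0 < β := lt_trans (by positivity) hβ
  have hatβ : Real.arctan C < β * (π/2) := by
    have := mul_lt_mul_of_pos_right hβ (show 0 < π/2 by positivity)
    have e : 2/π * Real.arctan C * (π/2) = Real.arctan C := by field_simp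
    linarith
  have harg : ∀ ζ ∈ Metric.ball (0:ℂ) 1, |(q ζ).arg / β| < π/2 := by
    intro ζ hζ
    have hr := hre ζ hζ
    have h1 : |(q ζ).arg| < π/2 := Complex.abs_arg_lt_pi_div_two_iff.2 (Or.inl hr)
    have h2 : (q ζ).arg = Real.arctan ((q ζ).im / (q ζ).re) := by
      rw [← Complex.tan_arg, Real.arctan_tan (abs_lt.1 h1).1 (abs_lt.1 h1).2]
    have h3 := abs_le.1 (hs ζ hζ)
    have h4 : |(q ζ).arg| ≤ Real.arctan C := by
      rw [h2, abs_le, ← Real.arctan_neg]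
      constructor
      · apply Real.arctan_mono
        rw [le_div_iff₀ hr]; linarith
      · apply Real.arctan_mono
        rw [div_le_iff₀ hr]; linarith
    rw [abs_div, abs_of_pos hβ0, div_lt_iff₀ hβ0]
    linarith
  have hslit : ∀ ζ ∈ Metric.ball (0:ℂ) 1, q ζ ∈ Complex.slitPlane := fun ζ hζ => Or.inl (hre ζ hζ)
  set Q : ℂ → ℂ := fun ζ => Complex.exp (Complex.log (q ζ) / β) with hQ
  have hQd : DifferentiableOn ℂ Q (Metric.ball 0 1) :=
    ((hq.clog hslit).div_const _).cexp
  have im_eq : ∀ ζ, (Complex.log (q ζ) / β).im = (q ζ).arg / β := by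
    intro ζ
    rw [Complex.div_ofReal_im, Complex.log_im]
  have hQre : ∀ ζ, (Q ζ).re = ‖Q ζ‖ * Real.cos ((q ζ).arg / β) := by
    intro ζ
    simp only [hQ, Complex.exp_re, Complex.norm_exp, im_eq]
  have hcos : ∀ ζ ∈ Metric.ball (0:ℂ) 1, 0 < Real.cos ((q ζ).arg / β) := fun ζ hζ =>
    Real.cos_pos_of_mem_Ioo ⟨(abs_lt.1 (harg ζ hζ)).1, (abs_lt.1 (harg ζ hζ)).2⟩
  have hQp : ∀ ζ, 0 < ‖Q ζ‖ := fun ζ => norm_pos_iff.2 (Complex.exp_ne_zero _)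
  have key := lk_sp hQd (fun ζ hζ => by rw [hQre]; exact mul_pos (hQp ζ) (hcos ζ hζ)) hz
  have hqd : HasDerivAt q (deriv q z) z :=
    (hq.differentiableAt (Metric.isOpen_ball.mem_nhds hz')).hasDerivAt
  have hQder : HasDerivAt Q (Q z * (deriv q z / q z / β)) z :=
    ((hqd.clog (hslit z hz')).div_const _).cexp
  have hqp : 0 < ‖q z‖ := by
    rw [norm_pos_iff]; intro h; have := hre z hz'; rw [h] at this; simp at this
  rw [hQder.deriv, hQre, norm_mul, norm_div, norm_div, Complex.norm_real,
    Real.norm_of_nonneg hβ0.le] at key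
  have k2 : ‖deriv q z‖ / ‖q z‖ / β * (1 - ‖z‖^2) ≤ 2 * Real.cos ((q z).arg / β) := by
    have := hQp z
    by_contra! hcon
    nlinarith [mul_lt_mul_of_pos_left hcon this]
  have k3 : Real.cos ((q z).arg / β) ≤ Real.cos ((q z).arg) := by
    rw [← Real.cos_abs, ← Real.cos_abs (q z).arg]
    apply Real.cos_le_cos_of_nonneg_of_le_pi (abs_nonneg _)
    · have := harg z hz'; linarith [Real.pi_pos]
    · rw [abs_div, abs_of_pos hβ0, le_div_iff₀ hβ0]
      nlinarith [abs_nonneg (q z).arg]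
  have k4 : ‖q z‖ * Real.cos (q z).arg = (q z).re := Complex.norm_mul_cos_arg _
  have k5 : ‖deriv q z‖ * (1 - ‖z‖^2) = β * (‖q z‖ * (‖deriv q z‖ / ‖q z‖ / β * (1 - ‖z‖^2))) := by
    field_simp
  rw [k5, ← k4]
  have := mul_le_mul_of_nonneg_left (k2.trans (mul_le_mul_of_nonneg_left k3 zero_le_two)) hqp.le
  have := mul_le_mul_of_nonneg_left this hβ0.le
  linarith

/-- Lipschitz and Taylor bounds for `z * q z`. -/
lemma lk_taylor {R : ℝ} (hR : R < 1) : ∃ K > 0, ∀ q : ℂ → ℂ,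
    DifferentiableOn ℂ q (Metric.ball 0 1) →
    (∀ z ∈ Metric.ball (0:ℂ) 1, 0 < (q z).re) → q 0 = 1 →
    ∀ a b : ℂ, ‖a‖ ≤ R → ‖b - a‖ < (1 - R) / 2 →
    ‖b * q b - a * q a‖ ≤ K * ‖b - a‖ ∧
    ‖b * q b - a * q a - (q a + a * deriv q a) * (b - a)‖ ≤ K * ‖b - a‖^2 := by
  set ρ := (1 - R) / 2 with hρ
  have hρ0 : 0 < ρ := by rw [hρ]; linarith
  set L := (4 / ρ) / ρ with hL
  have hL0 : 0 < L := by positivity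
  refine ⟨L + 2 * L / ρ, by positivity, ?_⟩
  intro q hq hre h1 a b ha hb
  set h : ℂ → ℂ := fun z => z * q z with hh
  have hsub : ∀ z ∈ Metric.ball a ρ, ‖z‖ ≤ 1 - ρ := by
    intro z hz
    have : ‖z - a‖ < ρ := by simpa [dist_eq_norm] using hz
    have h2 : ‖z‖ ≤ ‖z - a‖ + ‖a‖ := by simpa using norm_add_le (z - a) a
    rw [hρ] at *; linarith
  have hsub' : Metric.ball a ρ ⊆ Metric.ball 0 1 := fun z hz => by
    have := hsub z hz
    simp; linarith
  have hbd : ∀ z ∈ Metric.ball a ρ, ‖h z‖ ≤ 2 / ρ := by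
    intro z hz
    have e := hsub z hz
    have := lk_bd hq hre h1 (z := z) (by linarith)
    have h3 : 2 / (1 - ‖z‖) ≤ 2 / ρ := by
      apply div_le_div_of_nonneg_left <;> linarith
    simp only [hh, norm_mul]
    calc ‖z‖ * ‖q z‖ ≤ 1 * ‖q z‖ := by gcongr; linarith
      _ ≤ _ := by linarith
  have hd : DifferentiableOn ℂ h (Metric.ball a ρ) :=
    (differentiableOn_id.mul hq).mono hsub'
  have haa : a ∈ Metric.ball a ρ := Metric.mem_ball_self hρ0
  have hbb : b ∈ Metric.ball a ρ := by simpa [dist_eq_norm] using hb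
  have hmaps : MapsTo h (Metric.ball a ρ) (Metric.closedBall (h a) (4/ρ)) := by
    intro z hz
    rw [mem_closedBall_iff_norm]
    have := norm_sub_le (h z) (h a)
    have e : 4 / ρ = 2/ρ + 2/ρ := by ring
    linarith [hbd z hz, hbd a haa]
  have l1 := Complex.dist_le_div_mul_dist_of_mapsTo_ball hd hmaps hbb
  have l2 : ∀ z ∈ Metric.ball a ρ, ‖dslope h a z‖ ≤ L := fun z hz =>
    Complex.norm_dslope_le_div_of_mapsTo_ball hd hmaps hz
  have hdd : DifferentiableOn ℂ (dslope h a) (Metric.ball a ρ) :=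
    (Complex.differentiableOn_dslope (Metric.isOpen_ball.mem_nhds haa)).2 hd
  have hmaps2 : MapsTo (dslope h a) (Metric.ball a ρ) (Metric.closedBall (dslope h a a) (2 * L)) := by
    intro z hz
    rw [mem_closedBall_iff_norm]
    have := norm_sub_le (dslope h a z) (dslope h a a)
    linarith [l2 z hz, l2 a haa]
  have l3 := Complex.dist_le_div_mul_dist_of_mapsTo_ball hdd hmaps2 hbb
  have hder : deriv h a = q a + a * deriv q a := by
    have hqd : HasDerivAt q (deriv q a) a :=
      (hq.differentiableAt (Metric.isOpen_ball.mem_nhds (hsub' haa))).hasDerivAt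
    have h5 : HasDerivAt h (1 * q a + a * deriv q a) a := (hasDerivAt_id a).mul hqd
    rw [h5.deriv, one_mul]
  rw [dist_eq_norm, dist_eq_norm] at l1 l3
  constructor
  · refine l1.trans ?_
    gcongr
    have : 0 < 2 * L / ρ := by positivity
    linarith
  · have e : b * q b - a * q a - (q a + a * deriv q a) * (b - a)
        = (b - a) * (dslope h a b - dslope h a a) := by
      have := sub_smul_dslope h a b
      rw [smul_eq_mul] at this
      have h6 : h b - h a = b * q b - a * q a := rfl
      rw [dslope_same, hder, mul_sub (b - a), this, h6]
      ring
    rw [e, norm_mul]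
    calc ‖b - a‖ * ‖dslope h a b - dslope h a a‖ ≤ ‖b-a‖ * (2 * L / ρ * ‖b-a‖) := by gcongr
      _ = 2 * L / ρ * ‖b-a‖^2 := by ring
      _ ≤ _ := by gcongr; linarith

section LKaux

structure LKSys (C : ℝ) (p : ℂ → ℝ → ℂ) (w : ℂ → ℝ → ℂ) : Prop where
  C_pos : 0 < C
  holo : ∀ t ≥ (0 : ℝ), DifferentiableOn ℂ (fun z => p z t) (Metric.ball (0 : ℂ) 1)
  one : ∀ t ≥ (0 : ℝ), p 0 t = 1
  re : ∀ t ≥ (0 : ℝ), ∀ z ∈ Metric.ball (0 : ℂ) 1, 0 < (p z t).re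
  sector : ∀ t ≥ (0 : ℝ), ∀ z ∈ Metric.ball (0 : ℂ) 1, |(p z t).im| ≤ C * (p z t).re
  mem : ∀ z ∈ Metric.ball (0 : ℂ) 1, ∀ t ≥ (0 : ℝ), w z t ∈ Metric.ball (0 : ℂ) 1
  init : ∀ z ∈ Metric.ball (0 : ℂ) 1, w z 0 = z
  der : ∀ z ∈ Metric.ball (0 : ℂ) 1, ∀ t ≥ (0 : ℝ),
      HasDerivWithinAt (fun s => w z s) (-(w z t * p (w z t) t)) (Ici (0 : ℝ)) t
  wholo : ∀ t ≥ (0 : ℝ), DifferentiableOn ℂ (fun z => w z t) (Metric.ball (0 : ℂ) 1)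

lemma lk_anti {f f' : ℝ → ℝ} {a b : ℝ} (ha : 0 ≤ a) (hab : a ≤ b)
    (hd : ∀ s ∈ Icc a b, HasDerivWithinAt f (f' s) (Ici 0) s) (hf : ∀ s ∈ Ioo a b, f' s ≤ 0) :
    f b ≤ f a := by
  have hsub : Icc a b ⊆ Ici 0 := fun s hs => ha.trans hs.1
  have : AntitoneOn f (Icc a b) := by
    apply antitoneOn_of_hasDerivWithinAt_nonpos (convex_Icc a b)
      (fun s hs => (hd s hs).continuousWithinAt.mono hsub) (f' := f')
    · intro s hs
      exact (hd s (interior_subset hs)).mono (interior_subset.trans hsub)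
    · intro s hs
      rw [interior_Icc] at hs
      exact hf s hs
  exact this ⟨le_rfl, hab⟩ ⟨hab, le_rfl⟩ hab

lemma lk_inner (a b : ℂ) : inner ℝ a (-(a * b)) = -(‖a‖^2 * b.re) := by
  rw [Complex.inner, ← Complex.normSq_eq_norm_sq, Complex.normSq_apply]
  simp; ring

variable {C : ℝ} {p w : ℂ → ℝ → ℂ}

lemma LKSys.derN (H : LKSys C p w) {z : ℂ} (hz : z ∈ Metric.ball (0:ℂ) 1) {t : ℝ} (ht : 0 ≤ t) :
    HasDerivWithinAt (fun s => ‖w z s‖^2) (-2 * (‖w z t‖^2 * (p (w z t) t).re)) (Ici 0) t := by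
  have := (H.der z hz t ht).norm_sq
  refine this.congr_deriv ?_
  rw [lk_inner]; ring

lemma LKSys.anti (H : LKSys C p w) {z : ℂ} (hz : z ∈ Metric.ball (0:ℂ) 1) {s t : ℝ} (hs : 0 ≤ s)
    (hst : s ≤ t) : ‖w z t‖ ≤ ‖w z s‖ := by
  have : ‖w z t‖^2 ≤ ‖w z s‖^2 := by
    apply lk_anti hs hst (f := fun s => ‖w z s‖^2) (fun u hu => H.derN hz (hs.trans hu.1))
    intro u hu
    have h0 : 0 ≤ u := hs.trans hu.1.le
    have := H.re u h0 _ (H.mem z hz u h0)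
    have : 0 ≤ ‖w z u‖^2 * (p (w z u) u).re := by positivity
    linarith
  exact le_of_sq_le_sq this (norm_nonneg _)

lemma LKSys.diff_bound (H : LKSys C p w) {β : ℝ} (hβ : (2/π) * Real.arctan C < β) (hβ1 : β < 1)
    {z : ℂ} (hz : ‖z‖ < 1) {t : ℝ} (ht : 0 ≤ t) :
    ∃ K : ℝ, ∃ η > 0, ∀ z₁, ‖z₁ - z‖ < η →
      ‖w z₁ t - w z t‖ ≤ ‖z₁ - z‖ * (1 - ‖z‖^2)^(-β) * Real.exp (K * ‖z₁ - z‖) := by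
  have hz' : z ∈ Metric.ball (0:ℂ) 1 := by simpa using hz
  have hat : 0 < Real.arctan C := Real.arctan_pos.2 H.C_pos
  have hβ0 : 0 < β := lt_trans (by positivity) hβ
  obtain ⟨K, hK, hT⟩ := lk_taylor hz
  set ρ := 1 - ‖z‖ with hρ
  have hρ0 : 0 < ρ := by rw [hρ]; linarith
  refine ⟨K * (2/ρ) * t, min ρ (ρ^2/4), by positivity, ?_⟩
  intro z₁ hz₁
  have hzρ : ‖z₁ - z‖ < ρ := lt_of_lt_of_le hz₁ (min_le_left _ _)
  have hzρ2 : ‖z₁ - z‖ < ρ^2/4 := lt_of_lt_of_le hz₁ (min_le_right _ _)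
  have hsub : Metric.ball z ρ ⊆ Metric.ball 0 1 := by
    intro y hy
    have h1 : ‖y - z‖ < ρ := by simpa [dist_eq_norm] using hy
    have h2 : ‖y‖ ≤ ‖y - z‖ + ‖z‖ := by simpa using norm_add_le (y - z) z
    simp; linarith
  have hz₁b : z₁ ∈ Metric.ball z ρ := by simpa [dist_eq_norm] using hzρ
  have hz₁' := hsub hz₁b
  set D := 2/ρ * ‖z₁ - z‖ with hD
  have hlip : ∀ s ≥ (0:ℝ), ‖w z₁ s - w z s‖ ≤ D := by
    intro s hs
    have := Complex.dist_le_div_mul_dist_of_mapsTo_ball (R₂ := 2) ((H.wholo s hs).mono hsub) (by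
      intro y hy
      have h1 := H.mem y (hsub hy) s hs
      have h2 := H.mem z hz' s hs
      rw [mem_ball_zero_iff] at h1 h2
      rw [mem_closedBall_iff_norm]
      have := norm_sub_le (w y s) (w z s)
      simp only
      linarith) hz₁b
    simpa [dist_eq_norm] using this
  have hDρ : D < ρ/2 := by
    rw [hD, div_mul_eq_mul_div, div_lt_iff₀ hρ0]; nlinarith
  -- the monotone quantity
  set x : ℝ → ℝ := fun s => 1 - ‖w z s‖^2 with hx
  set N : ℝ → ℝ := fun s => ‖w z₁ s - w z s‖^2 with hN
  set x' : ℝ → ℝ := fun s => 2 * (‖w z s‖^2 * (p (w z s) s).re) with hx'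
  set N' : ℝ → ℝ := fun s => 2 * inner ℝ (w z₁ s - w z s)
    (-(w z₁ s * p (w z₁ s) s) - -(w z s * p (w z s) s)) with hN'
  have hxpos : ∀ s ≥ (0:ℝ), 0 < x s := by
    intro s hs
    have := H.mem z hz' s hs
    rw [mem_ball_zero_iff] at this
    simp only [hx]; nlinarith [norm_nonneg (w z s)]
  have dx : ∀ s ≥ (0:ℝ), HasDerivWithinAt x (x' s) (Ici 0) s := by
    intro s hs
    exact ((H.derN hz' hs).const_sub 1).congr_deriv (by simp only [hx']; ring)
  have dN : ∀ s ≥ (0:ℝ), HasDerivWithinAt N (N' s) (Ici 0) s := by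
    intro s hs
    exact ((H.der z₁ hz₁' s hs).sub (H.der z hz' s hs)).norm_sq
  have dE : ∀ s : ℝ, HasDerivWithinAt (fun s => Real.exp (-(2*K*D) * s))
      (Real.exp (-(2*K*D) * s) * (-(2*K*D))) (Ici 0) s := by
    intro s
    have : HasDerivAt (fun s : ℝ => -(2*K*D) * s) (-(2*K*D)) s := by
      simpa using (hasDerivAt_id s).const_mul (-(2*K*D))
    exact this.exp.hasDerivWithinAt
  have dΦ : ∀ s ≥ (0:ℝ), HasDerivWithinAt (fun s => N s * x s ^ (-(2*β)) * Real.exp (-(2*K*D) * s))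
      (x s ^ (-(2*β)) * Real.exp (-(2*K*D) * s) *
        (N' s - 2 * β * N s * (x' s / x s) - 2*K*D * N s)) (Ici 0) s := by
    intro s hs
    have h1 := ((dN s hs).mul ((dx s hs).rpow_const (p := -(2*β)) (Or.inl (hxpos s hs).ne'))).mul (dE s)
    refine h1.congr_deriv ?_
    simp only [Pi.mul_apply]
    rw [Real.rpow_sub_one (hxpos s hs).ne']
    ring
  have hΦ := lk_anti le_rfl ht (fun s hs => dΦ s hs.1) (by
    intro s hs
    have hs0 : 0 ≤ s := hs.1.le
    apply mul_nonpos_of_nonneg_of_nonpos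
    · have := hxpos s hs0; positivity
    have hm := H.mem z hz' s hs0
    have hrp := H.re s hs0 _ hm
    have hm' : ‖w z s‖ < 1 := by simpa using hm
    have hsec := lk_sector H.C_pos hβ hβ1 (H.holo s hs0) (H.re s hs0) (H.sector s hs0) hm'
    have hR : ‖w z s‖ ≤ ‖z‖ := by
      have := H.anti hz' le_rfl hs0
      rwa [H.init z hz'] at this
    have hδ := hlip s hs0
    have hT2 := (hT (fun y => p y s) (H.holo s hs0) (H.re s hs0) (H.one s hs0) (w z s) (w z₁ s) hR
      (by linarith)).2
    set δ := w z₁ s - w z s with hδd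
    set a := w z s with ha
    set P := p a s with hP
    set P' := deriv (fun y => p y s) a with hP'
    set e := w z₁ s * p (w z₁ s) s - a * P - (P + a * P') * δ with he
    have hNe : N s = ‖δ‖^2 := rfl
    have hN'e : N' s = 2 * (-(‖δ‖^2 * (P + a * P').re) - inner ℝ δ e) := by
      simp only [hN']
      rw [← lk_inner, ← inner_sub_right]
      congr 2
      rw [he]; ring
    have hin : -inner ℝ δ e ≤ K * D * ‖δ‖^2 := by
      have h1 := abs_real_inner_le_norm δ e
      have h2 := neg_abs_le (inner ℝ δ e)
      have h3 : ‖δ‖ * ‖e‖ ≤ ‖δ‖ * (K * ‖δ‖^2) := by gcongr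
      have h4 : ‖δ‖ * (K * ‖δ‖^2) ≤ D * (K * ‖δ‖^2) := by gcongr
      linarith
    have hxs := hxpos s hs0
    have hxe : x s = 1 - ‖a‖^2 := rfl
    have hx'e : x' s = 2 * (‖a‖^2 * P.re) := rfl
    have hre : P.re - ‖a‖ * (2 * β * P.re / x s) ≤ (P + a * P').re := by
      have h1 : ‖P'‖ ≤ 2 * β * P.re / x s := by
        rw [le_div_iff₀ hxs]; exact hsec
      have h2 := Complex.abs_re_le_norm (a * P')
      rw [norm_mul] at h2
      have h3 := neg_abs_le (a * P').re
      have h4 : ‖a‖ * ‖P'‖ ≤ ‖a‖ * (2 * β * P.re / x s) := by gcongr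
      rw [Complex.add_re]; linarith
    have hmain : -(P.re - ‖a‖ * (2 * β * P.re / x s)) ≤ 2 * β * (‖a‖^2 * P.re) / x s := by
      rw [← sub_nonneg]
      have : 2 * β * (‖a‖^2 * P.re) / x s - -(P.re - ‖a‖ * (2 * β * P.re / x s))
        = P.re * (x s - 2 * β * ‖a‖ * (1 - ‖a‖)) / x s := by field_simp; ring
      rw [this]
      apply div_nonneg _ hxs.le
      apply mul_nonneg hrp.le
      rw [hxe]
      have h0 := norm_nonneg a
      have : 1 - ‖a‖^2 - 2 * β * ‖a‖ * (1 - ‖a‖) = (1 - ‖a‖) * ((1 - ‖a‖) + 2 * (1 - β) * ‖a‖) := by ring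
      rw [this]
      apply mul_nonneg (by linarith)
      have : 0 ≤ 2 * (1 - β) * ‖a‖ := mul_nonneg (by linarith) h0
      linarith
    have hδ2 : 0 ≤ ‖δ‖^2 := by positivity
    have h5 := mul_le_mul_of_nonneg_left ((neg_le_neg hre).trans hmain) hδ2
    rw [hN'e, hNe, hx'e]
    have h6 : 2 * β * ‖δ‖^2 * (2 * (‖a‖^2 * P.re) / x s) = 2 * (‖δ‖^2 * (2 * β * (‖a‖^2 * P.re) / x s)) := by
      ring
    rw [h6]
    linarith)
  simp only [hN, hx, H.init z hz', H.init z₁ hz₁', mul_zero, Real.exp_zero, mul_one] at hΦ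
  have hxt := hxpos t ht
  have hxt1 : 1 ≤ (1 - ‖w z t‖^2) ^ (-(2*β)) := by
    apply Real.one_le_rpow_of_pos_of_le_one_of_nonpos hxt
    · nlinarith [norm_nonneg (w z t)]
    · linarith
  have h7 : ‖w z₁ t - w z t‖^2 * Real.exp (-(2*K*D) * t) ≤ ‖z₁ - z‖^2 * (1 - ‖z‖^2)^(-(2*β)) := by
    refine le_trans ?_ hΦ
    apply mul_le_mul_of_nonneg_right _ (Real.exp_pos _).le
    exact le_mul_of_one_le_right (by positivity) hxt1
  have hx0 : 0 < 1 - ‖z‖^2 := by nlinarith [norm_nonneg z]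
  apply le_of_sq_le_sq _ (by positivity)
  rw [mul_pow, mul_pow, ← Real.rpow_mul_natCast hx0.le, ← Real.exp_nat_mul]
  have h8 : ‖w z₁ t - w z t‖^2 = ‖w z₁ t - w z t‖^2 * Real.exp (-(2*K*D) * t) * Real.exp (2*K*D*t) := by
    rw [mul_assoc, ← Real.exp_add]; ring_nf; simp
  rw [h8]
  refine (mul_le_mul_of_nonneg_right h7 (Real.exp_pos _).le).trans (le_of_eq ?_)
  congr 2
  · congr 1; push_cast; ring
  · rw [hD]; push_cast; ring

lemma LKSys.deriv_bound (H : LKSys C p w) {β : ℝ} (hβ : (2/π) * Real.arctan C < β) (hβ1 : β < 1)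
    {z : ℂ} (hz : ‖z‖ < 1) {t : ℝ} (ht : 0 ≤ t) :
    ‖deriv (fun z => w z t) z‖ ≤ (1 - ‖z‖^2)^(-β) := by
  obtain ⟨K, η, hη, h⟩ := H.diff_bound hβ hβ1 hz ht
  have hz' : z ∈ Metric.ball (0:ℂ) 1 := by simpa using hz
  have hd := ((H.wholo t ht).differentiableAt (Metric.isOpen_ball.mem_nhds hz')).hasDerivAt
  have h1 := (hasDerivAt_iff_tendsto_slope.1 hd).norm
  have h2 : Filter.Tendsto (fun y : ℂ => (1 - ‖z‖^2)^(-β) * Real.exp (K * ‖y - z‖)) (nhdsWithin z {z}ᶜ)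
      (nhds ((1 - ‖z‖^2)^(-β))) := by
    have : Continuous (fun y : ℂ => (1 - ‖z‖^2)^(-β) * Real.exp (K * ‖y - z‖)) := by fun_prop
    have := this.tendsto z
    simp only [sub_self, norm_zero, mul_zero, Real.exp_zero, mul_one] at this
    exact this.mono_left nhdsWithin_le_nhds
  refine le_of_tendsto_of_tendsto h1 h2 ?_
  filter_upwards [nhdsWithin_le_nhds (Metric.ball_mem_nhds z hη), self_mem_nhdsWithin] with y hy hy2
  have hyp : 0 < ‖y - z‖ := norm_pos_iff.2 (sub_ne_zero.2 hy2)
  have := h y (by simpa [dist_eq_norm] using hy)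
  rw [slope_def_field, norm_div, div_le_iff₀ hyp]
  linarith
lemma LKSys.disp (H : LKSys C p w) {z : ℂ} (hz : z ∈ Metric.ball (0:ℂ) 1) {s δ : ℝ} (hs : 0 ≤ s)
    (hδ : δ ≤ 1/2) (hr : 1 - δ ≤ ‖w z s‖) : ‖w z s - z‖ ≤ 2 * (1 + C) * δ := by
  have hC := H.C_pos
  have key := image_norm_le_of_norm_deriv_right_le_deriv_boundary' (f := fun u => w z u - z)
    (f' := fun u => -(w z u * p (w z u) u)) (a := 0) (b := s)
    (B := fun u => (1 + C) * (‖z‖^2 - ‖w z u‖^2))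
    (B' := fun u => (1 + C) * (2 * (‖w z u‖^2 * (p (w z u) u).re)))
    (fun u hu => ((H.der z hz u hu.1).continuousWithinAt.mono (fun v hv => hv.1)).sub_const z)
    (fun u hu => ((H.der z hz u hu.1).mono (fun v hv => hu.1.trans hv)).sub_const z)
    (by simp [H.init z hz])
    (fun u hu => ((continuousWithinAt_const.sub (H.derN hz hu.1).continuousWithinAt).const_mul _).mono
      (fun v hv => hv.1))
    (fun u hu => ((((H.derN hz hu.1).mono (fun v hv => hu.1.trans hv)).const_sub _).const_mul _).congr_deriv
      (by ring))
    (by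
      intro u hu
      have hre := H.re u hu.1 _ (H.mem z hz u hu.1)
      have hse := H.sector u hu.1 _ (H.mem z hz u hu.1)
      have h1 := Complex.norm_le_abs_re_add_abs_im (p (w z u) u)
      rw [abs_of_pos hre] at h1
      have h2 := H.anti hz hu.1 hu.2.le
      have h3 : 1/2 ≤ ‖w z u‖ := by linarith
      rw [norm_neg, norm_mul]
      have h4 : ‖w z u‖ * ‖p (w z u) u‖ ≤ ‖w z u‖ * ((1 + C) * (p (w z u) u).re) := by
        gcongr; linarith
      have h5 : 0 ≤ ‖w z u‖ * ((1 + C) * (p (w z u) u).re) := by positivity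
      nlinarith)
    (show s ∈ Icc 0 s from ⟨hs, le_rfl⟩)
  have hz1 : ‖z‖ < 1 := by simpa using hz
  have h6 : ‖z‖^2 - ‖w z s‖^2 ≤ 2 * δ := by
    have i1 : (1 - δ)^2 ≤ ‖w z s‖^2 := pow_le_pow_left₀ (by linarith) hr 2
    have i2 : ‖z‖^2 ≤ 1 := pow_le_one₀ (norm_nonneg z) hz1.le
    nlinarith [sq_nonneg δ]
  have h7 := mul_le_mul_of_nonneg_left h6 (show 0 ≤ 1 + C by linarith)
  linarith

lemma LKSys.sep (H : LKSys C p w) {t d : ℝ} (ht : 0 ≤ t) (hd : 0 < d) :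
    ∃ c > 0, ∀ z₁ ∈ Metric.ball (0:ℂ) 1, ∀ z₂ ∈ Metric.ball (0:ℂ) 1, d ≤ ‖z₁ - z₂‖ →
      c ≤ ‖w z₁ t - w z₂ t‖ := by
  have hC := H.C_pos
  set δ := min (1/2) (d / (8 * (1 + C))) with hδ
  have hδ0 : 0 < δ := by positivity
  have hδ1 : δ ≤ 1/2 := min_le_left _ _
  have hδd : 8 * (1 + C) * δ ≤ d := by
    have : δ ≤ d / (8 * (1 + C)) := min_le_right _ _
    rw [le_div_iff₀ (by positivity)] at this; linarith
  obtain ⟨K, hK, hT⟩ := lk_taylor (show 1 - δ/2 < 1 by linarith)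
  refine ⟨δ/4 * Real.exp (-(K * t)), by positivity, ?_⟩
  intro z₁ hz₁ z₂ hz₂ hdz
  have hcont : ContinuousOn (fun s => ‖w z₁ s - w z₂ s‖) (Icc 0 t) := fun s hs =>
    (((H.der z₁ hz₁ s hs.1).continuousWithinAt.sub (H.der z₂ hz₂ s hs.1).continuousWithinAt).norm).mono
      (fun v hv => hv.1)
  set T := {s ∈ Icc 0 t | δ/4 ≤ ‖w z₁ s - w z₂ s‖} with hTdef
  have hCδ : 0 < C * δ := by positivity
  have hTcl : IsClosed T := by
    have := hcont.preimage_isClosed_of_isClosed isClosed_Icc (isClosed_Ici (a := δ/4))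
    exact this
  have hTc : IsCompact T := isCompact_Icc.of_isClosed_subset hTcl (fun s hs => hs.1)
  have hTn : T.Nonempty := ⟨0, ⟨le_rfl, ht⟩, by
    rw [H.init z₁ hz₁, H.init z₂ hz₂]; nlinarith⟩
  have hmem := hTc.sSup_mem hTn
  set s₁ := sSup T with hs₁
  have hafter : ∀ s ∈ Ioc s₁ t, ‖w z₁ s - w z₂ s‖ < δ/4 := by
    intro s hs
    by_contra! hcon
    have : s ∈ T := ⟨⟨hmem.1.1.trans hs.1.le, hs.2⟩, hcon⟩
    exact absurd (le_csSup hTc.bddAbove this) (not_le.2 hs.1)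
  set N' : ℝ → ℝ := fun s => 2 * inner ℝ (w z₁ s - w z₂ s)
    (-(w z₁ s * p (w z₁ s) s) - -(w z₂ s * p (w z₂ s) s)) with hN'
  have dΦ : ∀ s ∈ Icc s₁ t, HasDerivWithinAt (fun s => -(‖w z₁ s - w z₂ s‖^2 * Real.exp (2*K*s)))
      (-((N' s + 2*K * ‖w z₁ s - w z₂ s‖^2) * Real.exp (2*K*s))) (Ici 0) s := by
    intro s hs
    have hs0 : 0 ≤ s := hmem.1.1.trans hs.1
    have dN := ((H.der z₁ hz₁ s hs0).sub (H.der z₂ hz₂ s hs0)).norm_sq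
    have hl : HasDerivAt (fun s : ℝ => 2*K * s) (2*K) s := by
      simpa using (hasDerivAt_id s).const_mul (2*K)
    have dE := hl.exp.hasDerivWithinAt (s := Ici 0)
    refine (dN.mul dE).neg.congr_deriv ?_
    simp only [hN', Pi.sub_apply]
    ring
  have hΦ := lk_anti hmem.1.1 hmem.1.2 dΦ (by
    intro s hs
    have hs0 : 0 ≤ s := hmem.1.1.trans hs.1.le
    have hds := hafter s ⟨hs.1, hs.2.le⟩
    have hR : ‖w z₁ s‖ ≤ 1 - δ/2 := by
      by_contra! hcon
      have h2 : 1 - δ ≤ ‖w z₂ s‖ := by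
        have := norm_sub_norm_le (w z₁ s) (w z₂ s)
        linarith
      have e1 := H.disp hz₁ hs0 hδ1 (by linarith)
      have e2 := H.disp hz₂ hs0 hδ1 h2
      have e3 : ‖z₁ - z₂‖ ≤ ‖w z₁ s - z₁‖ + ‖w z₁ s - w z₂ s‖ + ‖w z₂ s - z₂‖ := by
        have : z₁ - z₂ = -(w z₁ s - z₁) + (w z₁ s - w z₂ s) + (w z₂ s - z₂) := by ring
        rw [this]
        refine (norm_add₃_le).trans ?_
        rw [norm_neg]
      nlinarith
    have hT1 := (hT (fun y => p y s) (H.holo s hs0) (H.re s hs0) (H.one s hs0) (w z₁ s) (w z₂ s) hR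
      (by rw [norm_sub_rev]; linarith)).1
    rw [norm_sub_rev (w z₂ s)] at hT1
    have h1 := abs_real_inner_le_norm (w z₁ s - w z₂ s)
      (-(w z₁ s * p (w z₁ s) s) - -(w z₂ s * p (w z₂ s) s))
    have h2 := neg_abs_le (inner ℝ (w z₁ s - w z₂ s)
      (-(w z₁ s * p (w z₁ s) s) - -(w z₂ s * p (w z₂ s) s)))
    have h3 : ‖-(w z₁ s * p (w z₁ s) s) - -(w z₂ s * p (w z₂ s) s)‖ ≤ K * ‖w z₁ s - w z₂ s‖ := by
      refine le_trans (le_of_eq ?_) hT1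
      congr 1; ring
    have h4 : ‖w z₁ s - w z₂ s‖ * ‖-(w z₁ s * p (w z₁ s) s) - -(w z₂ s * p (w z₂ s) s)‖
      ≤ ‖w z₁ s - w z₂ s‖ * (K * ‖w z₁ s - w z₂ s‖) := by gcongr
    rw [neg_nonpos]
    apply mul_nonneg _ (Real.exp_pos _).le
    simp only [hN']
    nlinarith)
  simp only [neg_le_neg_iff] at hΦ
  apply le_of_sq_le_sq _ (norm_nonneg _)
  have h1 : (δ/4)^2 ≤ ‖w z₁ s₁ - w z₂ s₁‖^2 := by
    have := hmem.2; gcongr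
  have h2 : 1 ≤ Real.exp (2*K*s₁) := by
    apply Real.one_le_exp; have := hmem.1.1; positivity
  have h3 : (δ/4)^2 ≤ ‖w z₁ t - w z₂ t‖^2 * Real.exp (2*K*t) := by
    refine le_trans (h1.trans ?_) hΦ
    exact le_mul_of_one_le_right (by positivity) h2
  rw [mul_pow, ← Real.exp_nat_mul]
  calc (δ/4)^2 * Real.exp ((2:ℕ) * -(K*t)) ≤ ‖w z₁ t - w z₂ t‖^2 * Real.exp (2*K*t) * Real.exp ((2:ℕ) * -(K*t)) := by
        gcongr
    _ = ‖w z₁ t - w z₂ t‖^2 := by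
        rw [mul_assoc, ← Real.exp_add]; push_cast; ring_nf; simp

lemma lk_holder {β : ℝ} (hβ0 : 0 < β) (hβ1 : β < 1) {f : ℂ → ℂ}
    (hf : DifferentiableOn ℂ f (Metric.ball 0 1))
    (hd : ∀ z, ‖z‖ < 1 → ‖deriv f z‖ ≤ (1 - ‖z‖)^(-β)) (hm : ∀ z, ‖z‖ < 1 → ‖f z‖ ≤ 1)
    {z₁ z₂ : ℂ} (h₁ : ‖z₁‖ < 1) (h₂ : ‖z₂‖ < 1) :
    ‖f z₁ - f z₂‖ ≤ (2 / (1 - β) + 3) * ‖z₁ - z₂‖^(1 - β) := by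
  set d := ‖z₁ - z₂‖ with hdd
  have hdn : 0 ≤ d := norm_nonneg _
  have hγ : 0 < 1 - β := by linarith
  rcases eq_or_ne z₁ z₂ with h | h
  · subst h; simp; positivity
  have hd0 : 0 < d := norm_pos_iff.2 (sub_ne_zero.2 h)
  rcases le_or_gt 1 d with h1 | h1
  · have a1 := norm_sub_le (f z₁) (f z₂)
    have a2 := hm z₁ h₁
    have a3 := hm z₂ h₂
    have a4 : 1 ≤ d^(1-β) := Real.one_le_rpow h1 hγ.le
    have a5 : 0 < 2 / (1-β) := by positivity
    nlinarith
  have hda : ∀ z, ‖z‖ < 1 → HasDerivAt f (deriv f z) z := fun z hz =>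
    (hf.differentiableAt (Metric.isOpen_ball.mem_nhds (by simpa using hz))).hasDerivAt
  have rad : ∀ z : ℂ, ‖z‖ < 1 → ‖f z - f (((1 - d : ℝ) : ℂ) * z)‖ ≤ d^(1-β) / (1-β) := by
    intro z hz
    have hsz : ∀ s ∈ Icc (1-d) 1, ‖(s:ℂ) * z‖ < 1 ∧ ‖(s:ℂ) * z‖ ≤ s := by
      intro s hs
      have hs0 : 0 ≤ s := by linarith [hs.1]
      rw [norm_mul, Complex.norm_real, Real.norm_of_nonneg hs0]
      constructor
      · have := hs.2; nlinarith [norm_nonneg z]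
      · nlinarith [norm_nonneg z]
    have hder : ∀ s ∈ Icc (1-d) 1, HasDerivAt (fun s : ℝ => f ((s:ℂ) * z) - f (((1 - d : ℝ) : ℂ) * z))
        (deriv f ((s:ℂ) * z) * z) s := by
      intro s hs
      have e1 : HasDerivAt (fun y : ℂ => y * z) z (s:ℂ) := by
        simpa using (hasDerivAt_id (s:ℂ)).mul_const z
      have e2 : HasDerivAt (fun y : ℂ => f (y * z)) (deriv f ((s:ℂ) * z) * z) (s:ℂ) :=
        (hda _ (hsz s hs).1).comp (s:ℂ) e1
      exact e2.comp_ofReal.sub_const _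
    have key := image_norm_le_of_norm_deriv_right_le_deriv_boundary'
      (f := fun s : ℝ => f ((s:ℂ) * z) - f (((1 - d : ℝ) : ℂ) * z))
      (f' := fun s : ℝ => deriv f ((s:ℂ) * z) * z) (a := 1 - d) (b := 1)
      (B := fun s => (d^(1-β) - (1-s)^(1-β)) / (1-β))
      (B' := fun s => (1-s)^(-β))
      (fun s hs => (hder s hs).continuousAt.continuousWithinAt)
      (fun s hs => (hder s ⟨hs.1, hs.2.le⟩).hasDerivWithinAt)
      (by simp)
      (by
        apply ContinuousOn.div_const
        apply ContinuousOn.sub continuousOn_const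
        apply ContinuousOn.rpow_const (by fun_prop)
        intro s hs; right; exact hγ.le)
      (by
        intro s hs
        have e0 : 1 - s ≠ 0 := by linarith [hs.2]
        have e1 : HasDerivAt (fun s : ℝ => 1 - s) (-1) s := by
          simpa using (hasDerivAt_id s).const_sub 1
        have e2 := ((e1.rpow_const (p := 1-β) (Or.inl e0)).const_sub (d^(1-β))).div_const (1-β)
        refine (e2.congr_deriv ?_).hasDerivWithinAt
        rw [show 1 - β - 1 = -β by ring]
        field_simp)
      (by
        intro s hs
        have hs' : s ∈ Icc (1-d) 1 := ⟨hs.1, hs.2.le⟩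
        have e0 : 0 < 1 - s := by linarith [hs.2]
        have e1 := hd _ (hsz s hs').1
        have e2 : (1 - ‖(s:ℂ) * z‖)^(-β) ≤ (1-s)^(-β) :=
          Real.rpow_le_rpow_of_nonpos e0 (by linarith [(hsz s hs').2]) (by linarith)
        rw [norm_mul]
        calc ‖deriv f ((s:ℂ) * z)‖ * ‖z‖ ≤ ‖deriv f ((s:ℂ) * z)‖ * 1 := by gcongr
          _ ≤ _ := by linarith)
      (show (1:ℝ) ∈ Icc (1-d) 1 from ⟨by linarith, le_rfl⟩)
    simpa [Real.zero_rpow hγ.ne'] using key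
  have hin : ∀ z : ℂ, ‖z‖ < 1 → ((1 - d : ℝ) : ℂ) * z ∈ Metric.closedBall (0:ℂ) (1-d) := by
    intro z hz
    rw [mem_closedBall_zero_iff, norm_mul, Complex.norm_real, Real.norm_of_nonneg (by linarith)]
    nlinarith [norm_nonneg z]
  have mid := (convex_closedBall (0:ℂ) (1-d)).norm_image_sub_le_of_norm_deriv_le (f := f) (C := d^(-β))
    (fun z hz => (hda z (by rw [mem_closedBall_zero_iff] at hz; linarith)).differentiableAt)
    (fun z hz => by
      rw [mem_closedBall_zero_iff] at hz
      refine (hd z (by linarith)).trans ?_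
      exact Real.rpow_le_rpow_of_nonpos hd0 (by linarith) (by linarith))
    (hin z₂ h₂) (hin z₁ h₁)
  rw [← mul_sub, norm_mul, Complex.norm_real, Real.norm_of_nonneg (by linarith : 0 ≤ 1 - d)] at mid
  have mid2 : ‖f (((1 - d : ℝ) : ℂ) * z₁) - f (((1 - d : ℝ) : ℂ) * z₂)‖ ≤ d^(1-β) := by
    refine mid.trans ?_
    have e : d^(1-β) = d^(-β) * d := by
      rw [sub_eq_neg_add, Real.rpow_add_one hd0.ne']
    rw [e]
    gcongr
    nlinarith
  have tri : ‖f z₁ - f z₂‖ ≤ ‖f z₁ - f (((1 - d : ℝ) : ℂ) * z₁)‖ +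
      ‖f (((1 - d : ℝ) : ℂ) * z₁) - f (((1 - d : ℝ) : ℂ) * z₂)‖ + ‖f z₂ - f (((1 - d : ℝ) : ℂ) * z₂)‖ := by
    rw [norm_sub_rev (f z₂)]
    refine le_trans (le_of_eq ?_) norm_add₃_le
    congr 1; ring
  have r1 := rad z₁ h₁
  have r2 := rad z₂ h₂
  have e : (2 / (1 - β) + 3) * d^(1-β) = d^(1-β)/(1-β) + d^(1-β)/(1-β) + 3 * d^(1-β) := by ring
  have : 0 ≤ d^(1-β) := by positivity
  rw [e]; linarith

end LKaux



/-- If the driving term takes values in the sector `|Im p| ≤ C·Re p` (with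
`p(0,t) = 1`), then with `α = (2/π)·arctan C`, for each `t` and each `0 < ε < 1-α` the
univalent solution `z ↦ w(z,t)` extends to an injective Hölder map of exponent `1-α-ε` on
the closed unit disc; in particular the boundary of `w(𝔻,t)` is a Jordan curve. -/
theorem loewner_kufarev_sector_jordan
    (C : ℝ) (hC : 0 < C)
    (p : ℂ → ℝ → ℂ)
    (hp_holo : ∀ t ≥ (0 : ℝ), DifferentiableOn ℂ (fun z => p z t) (Metric.ball (0 : ℂ) 1))
    (hp_one : ∀ t ≥ (0 : ℝ), p 0 t = 1)
    (hp_re : ∀ t ≥ (0 : ℝ), ∀ z ∈ Metric.ball (0 : ℂ) 1, 0 < (p z t).re)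
    (hp_sector : ∀ t ≥ (0 : ℝ), ∀ z ∈ Metric.ball (0 : ℂ) 1,
      |(p z t).im| ≤ C * (p z t).re)
    (w : ℂ → ℝ → ℂ)
    (hw_mem : ∀ z ∈ Metric.ball (0 : ℂ) 1, ∀ t ≥ (0 : ℝ),
      w z t ∈ Metric.ball (0 : ℂ) 1)
    (hw_init : ∀ z ∈ Metric.ball (0 : ℂ) 1, w z 0 = z)
    (hw_deriv : ∀ z ∈ Metric.ball (0 : ℂ) 1, ∀ t ≥ (0 : ℝ),
      HasDerivWithinAt (fun s => w z s) (-(w z t * p (w z t) t)) (Ici (0 : ℝ)) t)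
    (hw_holo : ∀ t ≥ (0 : ℝ), DifferentiableOn ℂ (fun z => w z t) (Metric.ball (0 : ℂ) 1))
    (hw_inj : ∀ t ≥ (0 : ℝ), InjOn (fun z => w z t) (Metric.ball (0 : ℂ) 1)) :
    ∀ t ≥ (0 : ℝ), ∀ ε : ℝ, 0 < ε → ε < 1 - (2 / π) * Real.arctan C →
      ∃ M > (0 : ℝ), ∃ W : ℂ → ℂ,
        ContinuousOn W (Metric.closedBall (0 : ℂ) 1) ∧
        InjOn W (Metric.closedBall (0 : ℂ) 1) ∧
        (∀ z ∈ Metric.ball (0 : ℂ) 1, W z = w z t) ∧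
        (∀ z₁ ∈ Metric.closedBall (0 : ℂ) 1, ∀ z₂ ∈ Metric.closedBall (0 : ℂ) 1,
          ‖W z₁ - W z₂‖ ≤ M * ‖z₁ - z₂‖ ^ (1 - (2 / π) * Real.arctan C - ε)) := by
  intro t ht ε hε hε1
  have H : LKSys C p w := ⟨hC, hp_holo, hp_one, hp_re, hp_sector, hw_mem, hw_init, hw_deriv, hw_holo⟩
  set β := (2 / π) * Real.arctan C + ε with hβ
  have hat : 0 < Real.arctan C := Real.arctan_pos.2 hC
  have hβ0 : 0 < β := by positivity
  have hβ1 : β < 1 := by linarith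
  have hexp : 1 - (2 / π) * Real.arctan C - ε = 1 - β := by rw [hβ]; ring
  have hγ : 0 < 1 - β := by linarith
  rw [hexp]
  set M := 2 / (1 - β) + 3 with hM
  have hM0 : 0 < M := by positivity
  have hol : ∀ z₁ z₂ : ℂ, ‖z₁‖ < 1 → ‖z₂‖ < 1 → ‖w z₁ t - w z₂ t‖ ≤ M * ‖z₁ - z₂‖^(1 - β) := by
    intro z₁ z₂ h₁ h₂
    refine lk_holder hβ0 hβ1 (hw_holo t ht) ?_ ?_ h₁ h₂
    · intro z hz
      refine (H.deriv_bound (by linarith) hβ1 hz ht).trans ?_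
      exact Real.rpow_le_rpow_of_nonpos (by linarith) (by nlinarith [norm_nonneg z]) (by linarith)
    · intro z hz
      have := hw_mem z (by simpa using hz) t ht
      rw [mem_ball_zero_iff] at this
      exact this.le
  -- radial approximations
  set a : ℕ → ℝ := fun n => 1 - 1 / ((n : ℝ) + 2) with ha
  have ha0 : ∀ n, 1/2 ≤ a n ∧ a n < 1 := by
    intro n
    have h1 : (2:ℝ) ≤ (n:ℝ) + 2 := by linarith [n.cast_nonneg (α := ℝ)]
    have h2 : 1 / ((n:ℝ) + 2) ≤ 1/2 := one_div_le_one_div_of_le (by norm_num) h1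
    have h3 : 0 < 1 / ((n:ℝ) + 2) := by positivity
    constructor <;> simp only [ha] <;> linarith
  have hat1 : Filter.Tendsto a Filter.atTop (nhds 1) := by
    have h1 : Filter.Tendsto (fun n : ℕ => (n:ℝ) + 2) Filter.atTop Filter.atTop :=
      Filter.tendsto_atTop_add_const_right _ _ tendsto_natCast_atTop_atTop
    have h2 := (h1.const_div_atTop 1).const_sub 1
    simpa [ha] using h2
  have han : ∀ n, ∀ z : ℂ, ‖z‖ ≤ 1 → ‖((a n : ℝ) : ℂ) * z‖ < 1 := by
    intro n z hz
    rw [norm_mul, Complex.norm_real, Real.norm_of_nonneg (by linarith [(ha0 n).1])]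
    nlinarith [(ha0 n).1, (ha0 n).2, norm_nonneg z]
  have hlim : ∀ z : ℂ, ∃ y : ℂ, ‖z‖ ≤ 1 →
      Filter.Tendsto (fun n => w (((a n : ℝ) : ℂ) * z) t) Filter.atTop (nhds y) := by
    intro z
    by_cases hz : ‖z‖ ≤ 1
    · have hc : CauchySeq (fun n => w (((a n : ℝ) : ℂ) * z) t) := by
        have hca := hat1.cauchySeq
        rw [Metric.cauchySeq_iff] at hca ⊢
        intro e he
        obtain ⟨n₀, hn₀⟩ := hca ((e / M) ^ (1 - β)⁻¹) (by positivity)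
        refine ⟨n₀, fun m hm n hn => ?_⟩
        have h1 := hn₀ m hm n hn
        rw [dist_eq_norm] at h1 ⊢
        refine (hol _ _ (han m z hz) (han n z hz)).trans_lt ?_
        have h2 : ‖((a m : ℝ) : ℂ) * z - ((a n : ℝ) : ℂ) * z‖ ≤ ‖a m - a n‖ := by
          rw [← sub_mul, norm_mul, ← Complex.ofReal_sub, Complex.norm_real]
          exact mul_le_of_le_one_right (norm_nonneg _) hz
        have h3 := Real.rpow_lt_rpow (norm_nonneg _) (h2.trans_lt h1) hγ
        rw [Real.rpow_inv_rpow (by positivity) hγ.ne', lt_div_iff₀ hM0] at h3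
        linarith
      obtain ⟨y, hy⟩ := cauchySeq_tendsto_of_complete hc
      exact ⟨y, fun _ => hy⟩
    · exact ⟨0, fun h => absurd h hz⟩
  choose W hW using hlim
  have hmul : ∀ z : ℂ, Filter.Tendsto (fun n => ((a n : ℝ) : ℂ) * z) Filter.atTop (nhds z) := by
    intro z
    have := ((Complex.continuous_ofReal.tendsto 1).comp hat1).mul_const z
    simpa using this
  have hWh : ∀ z₁ ∈ Metric.closedBall (0 : ℂ) 1, ∀ z₂ ∈ Metric.closedBall (0 : ℂ) 1,
          ‖W z₁ - W z₂‖ ≤ M * ‖z₁ - z₂‖ ^ (1 - β) := by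
    intro z₁ h₁ z₂ h₂
    rw [mem_closedBall_zero_iff] at h₁ h₂
    refine le_of_tendsto' ((hW z₁ h₁).sub (hW z₂ h₂)).norm (fun n => ?_)
    refine (hol _ _ (han n _ h₁) (han n _ h₂)).trans ?_
    gcongr
    rw [← mul_sub, norm_mul, Complex.norm_real, Real.norm_of_nonneg (by linarith [(ha0 n).1])]
    exact mul_le_of_le_one_left (norm_nonneg _) (ha0 n).2.le
  refine ⟨M, hM0, W, ?_, ?_, ?_, hWh⟩
  · intro z hz
    rw [ContinuousWithinAt, tendsto_iff_norm_sub_tendsto_zero]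
    have h1 : Filter.Tendsto (fun y : ℂ => M * ‖y - z‖^(1 - β))
        (nhdsWithin z (Metric.closedBall 0 1)) (nhds 0) := by
      have hcn : Continuous (fun y : ℂ => M * ‖y - z‖^(1 - β)) :=
        continuous_const.mul ((Real.continuous_rpow_const hγ.le).comp (by fun_prop))
      have := hcn.tendsto z
      simp only [sub_self, norm_zero, Real.zero_rpow hγ.ne', mul_zero] at this
      exact this.mono_left nhdsWithin_le_nhds
    refine squeeze_zero' (Filter.Eventually.of_forall fun y => norm_nonneg _) ?_ h1
    filter_upwards [self_mem_nhdsWithin] with y hy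
    exact hWh y hy z hz
  · intro z₁ h₁ z₂ h₂ heq
    by_contra hne
    rw [mem_closedBall_zero_iff] at h₁ h₂
    have hd : 0 < ‖z₁ - z₂‖ / 2 := by
      have := norm_pos_iff.2 (sub_ne_zero.2 hne); positivity
    obtain ⟨c, hc, hsep⟩ := H.sep ht hd
    have : c ≤ ‖W z₁ - W z₂‖ := by
      refine ge_of_tendsto' ((hW z₁ h₁).sub (hW z₂ h₂)).norm (fun n => ?_)
      refine hsep _ (by simpa using han n _ h₁) _ (by simpa using han n _ h₂) ?_
      rw [← mul_sub, norm_mul, Complex.norm_real, Real.norm_of_nonneg (by linarith [(ha0 n).1])]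
      nlinarith [(ha0 n).1, norm_nonneg (z₁ - z₂)]
    rw [heq, sub_self, norm_zero] at this
    linarith
  · intro z hz
    have hz1 : ‖z‖ < 1 := by simpa using hz
    have hcz := ((hw_holo t ht).differentiableAt (Metric.isOpen_ball.mem_nhds hz)).continuousAt
    exact tendsto_nhds_unique (hW z hz1.le) (hcz.tendsto.comp (hmul z))
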